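/- Let p ∈ (1, 2], f ∈ L^p(ℝ), and let v(x₁, x₂) = (f * g_{x₂})(x₁) with g_{x₂}(t) = x₂/(π(t² + x₂²)). Then for every R > 0, ∫_0^R ∫_ℝ v² dx₁ dx₂ ≤ (8p/(π^q(p+2)))^{2/q} · (q R^{2/q−1}/(2−q)) · ‖f‖²_{L^p}, where q = 2p/(3p−2). -/

import Mathlib

open MeasureTheory Set Real

theorem young (p q : ℝ) (hp : 1 < p) (hp2 : p ≤ 2) (hq : 1 ≤ q) (hq2 : q < 2)
    (hpq : 1/p + 1/q = 3/2) (F G : ℝ → ENNReal) (hF : Measurable F) (hG : Measurable G) :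
    ∫⁻ x, (∫⁻ t, F t * G (t - x)) ^ 2 ≤ (∫⁻ t, F t ^ p) ^ (2/p) * (∫⁻ t, G t ^ q) ^ (2/q) := by
  have hp0 : 0 < p := by linarith
  have hq0 : 0 < q := by linarith
  have h1p : 0 ≤ 1/p - 1/2 := by
    rw [sub_nonneg]; exact one_div_le_one_div_of_le hp0 hp2
  have h1q : 0 ≤ 1/q - 1/2 := by
    rw [sub_nonneg]; exact one_div_le_one_div_of_le hq0 hq2.le
  set A := ∫⁻ t, F t ^ p with hA
  set B := ∫⁻ t, G t ^ q with hB
  have key : ∀ x, (∫⁻ t, F t * G (t - x)) ^ 2 ≤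
      (∫⁻ t, F t ^ p * G (t - x) ^ q) * (A ^ (2/p - 1) * B ^ (2/q-1)) := by
    intro x
    have hGx : ∫⁻ t, G (t - x) ^ q = B := 
      lintegral_sub_right_eq_self (fun t => G t ^ q) x
    have hmG : Measurable (fun t => G (t - x)) := hG.comp (measurable_id.sub_const x)
    have h := ENNReal.lintegral_prod_norm_pow_le (μ := (volume : Measure ℝ)) (Finset.univ : Finset (Fin 3))
      (f := ![fun t => F t ^ p * G (t - x) ^ q, fun t => F t ^ p, fun t => G (t - x) ^ q])
      (p := ![1/2, 1/p - 1/2, 1/q - 1/2]) 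
      (by
        intro i _
        fin_cases i
        · exact ((hF.pow_const p).mul (hmG.pow_const q)).aemeasurable
        · exact (hF.pow_const p).aemeasurable
        · exact (hmG.pow_const q).aemeasurable)
      (by simp [Fin.sum_univ_three]; simp at hpq; linarith)
      (by intro i _; fin_cases i <;> simp at * <;> linarith)
    simp only [Fin.prod_univ_three, Matrix.cons_val_zero, Matrix.cons_val_one, Matrix.cons_val] at h
    rw [hGx, ← hA] at h
    have e : ∀ t, (F t ^ p * G (t - x) ^ q) ^ (1/2:ℝ) * (F t ^ p) ^ (1/p-1/2) * (G (t-x) ^ q) ^ (1/q - 1/2)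
        = F t * G (t - x) := by
      intro t
      rw [ENNReal.mul_rpow_of_nonneg _ _ (by norm_num)]
      simp only [← ENNReal.rpow_mul]
      have a1 : F t ^ (p * (1/2)) * F t ^ (p * (1/p - 1/2)) = F t := by
        rw [← ENNReal.rpow_add_of_nonneg _ _ (by positivity) (by positivity)]
        have : p * (1/2) + p * (1/p-1/2) = 1 := by field_simp; ring
        rw [this, ENNReal.rpow_one]
      have a2 : G (t-x) ^ (q * (1/2)) * G (t-x) ^ (q * (1/q - 1/2)) = G (t-x) := by
        rw [← ENNReal.rpow_add_of_nonneg _ _ (by positivity) (by positivity)]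
        have : q * (1/2) + q * (1/q-1/2) = 1 := by field_simp; ring
        rw [this, ENNReal.rpow_one]
      conv_rhs => rw [← a1, ← a2]
      ring
    simp only [e] at h
    calc _ ≤ _ := pow_le_pow_left' h 2
      _ = _ := by
        rw [mul_pow, mul_pow, mul_assoc]
        simp only [← ENNReal.rpow_natCast, ← ENNReal.rpow_mul]
        congr 2
        · norm_num
        · congr 1; push_cast; ring
        · congr 1; push_cast; ring
  have hmeas : Measurable (fun z : ℝ × ℝ => F z.2 ^ p * G (z.2 - z.1) ^ q) := by fun_prop
  calc _ ≤ ∫⁻ x, (∫⁻ t, F t ^ p * G (t - x) ^ q) * (A ^ (2/p - 1) * B ^ (2/q-1)) := lintegral_mono key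
    _ = (∫⁻ x, ∫⁻ t, F t ^ p * G (t - x) ^ q) * (A ^ (2/p - 1) * B ^ (2/q-1)) := 
        lintegral_mul_const _ hmeas.lintegral_prod_right'
    _ = (A * B) * (A ^ (2/p - 1) * B ^ (2/q-1)) := by
        rw [lintegral_lintegral_swap hmeas.aemeasurable]
        congr 1
        have : ∀ t, ∫⁻ x, F t ^ p * G (t - x) ^ q = F t ^ p * B := by
          intro t
          rw [lintegral_const_mul _ (by fun_prop), lintegral_sub_left_eq_self (fun t => G t ^ q)]
        simp only [this]
        rw [lintegral_mul_const _ (by fun_prop)]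
    _ = (A * A ^ (2/p - 1)) * (B * B ^ (2/q-1)) := by ring
    _ = _ := by
        have c : ∀ (A : ENNReal) (r : ℝ), 0 ≤ 1/r - 1/2 → A * A ^ (2/r-1) = A ^ (2/r) := by
          intro A r hr
          nth_rewrite 1 [← ENNReal.rpow_one A]
          rw [← ENNReal.rpow_add_of_nonneg _ _ (by norm_num) (by ring_nf at hr ⊢; linarith)]
          congr 1; ring
        rw [c A p h1p, c B q h1q]

theorem kern (q y : ℝ) (hq : 1 ≤ q) (hy : 0 < y) :
    ∫⁻ s, ‖y / (π * (s ^ 2 + y ^ 2))‖ₑ ^ q ≤ ENNReal.ofReal (4*q/(2*q-1) / π ^ q * y ^ (1-q)) := by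
  set G : ℝ → ENNReal := fun s => ‖y / (π * (s ^ 2 + y ^ 2))‖ₑ ^ q with hG
  have hyq : y ^ (1-q) = y * (y ^ q)⁻¹ := by rw [rpow_sub hy, rpow_one, div_eq_mul_inv]
  have b1 : ∀ s, G s = ENNReal.ofReal ((y / (π * (s ^ 2 + y ^ 2))) ^ q) := by
    intro s
    have : 0 ≤ y / (π * (s ^ 2 + y ^ 2)) := by positivity
    simp only [hG]
    rw [Real.enorm_of_nonneg this, ENNReal.ofReal_rpow_of_nonneg this (by linarith)]
  have i1 : ∫⁻ s in Ioi y, G s ≤ ENNReal.ofReal (1/(2*q-1) / π ^ q * y ^ (1-q)) := by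
    calc _ ≤ ∫⁻ s in Ioi y, ENNReal.ofReal ((y/π)^q * s ^ (-2*q)) := by
          refine setLIntegral_mono (by fun_prop) ?_
          intro s hs
          have hs0 : 0 < s := lt_trans hy hs
          rw [b1]
          apply ENNReal.ofReal_le_ofReal
          rw [rpow_mul hs0.le, ← mul_rpow (by positivity) (by positivity)]
          apply rpow_le_rpow (by positivity) _ (by linarith)
          rw [rpow_neg hs0.le, rpow_ofNat, ← div_eq_mul_inv, div_div]
          gcongr
          nlinarith [sq_nonneg y]
      _ = ENNReal.ofReal (∫ s in Ioi y, (y/π)^q * s ^ (-2*q)) := by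
          rw [ofReal_integral_eq_lintegral_ofReal]
          · exact (integrableOn_Ioi_rpow_of_lt (by linarith) hy).const_mul _
          · filter_upwards [ae_restrict_mem measurableSet_Ioi] with s hs
            have hs0 : 0 < s := lt_trans hy hs
            positivity
      _ ≤ _ := by
          apply ENNReal.ofReal_le_ofReal
          rw [integral_const_mul, integral_Ioi_rpow_of_lt (by linarith) hy, hyq,
            div_rpow hy.le pi_pos.le]
          have : y ^ (-2*q+1) = y * (y^q)⁻¹ * (y^q)⁻¹ := by
            rw [rpow_add hy, rpow_one, show -2*q = -q + -q by ring, rpow_add hy, rpow_neg hy.le]; ring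
          rw [this]
          have h1 : 0 < y ^ q := by positivity
          have h2 : 0 < π ^ q := by positivity
          have h3 : 2*q-1 ≠ 0 := by linarith
          have h4 : -2*q+1 ≠ 0 := by linarith
          apply le_of_eq
          rw [show -2*q+1 = -(2*q-1) by ring]
          field_simp
  have i2 : ∫⁻ s in Iio (-y), G s = ∫⁻ s in Ioi y, G s := by
    have := (Measure.measurePreserving_neg (volume : Measure ℝ)).setLIntegral_comp_preimage (s := Ioi y) measurableSet_Ioi (f := G) (by fun_prop)
    rw [← this]
    have e : (Neg.neg : ℝ → ℝ) ⁻¹' Ioi y = Iio (-y) := by simp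
    rw [e]
    simp [hG]
  have i3 : ∫⁻ s in Icc (-y) y, G s ≤ ENNReal.ofReal (2 / π ^ q * y ^ (1-q)) := by
    calc _ ≤ ∫⁻ s in Icc (-y) y, ENNReal.ofReal ((1/(π*y))^q) := by
          refine setLIntegral_mono (by fun_prop) ?_
          intro s hs
          rw [b1]
          apply ENNReal.ofReal_le_ofReal
          apply rpow_le_rpow (by positivity) _ (by linarith)
          rw [div_le_div_iff₀ (by positivity) (by positivity)]
          nlinarith [mul_nonneg pi_pos.le (sq_nonneg s)]
      _ ≤ _ := by
          rw [setLIntegral_const, Real.volume_Icc, ← ENNReal.ofReal_mul (by positivity)]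
          apply ENNReal.ofReal_le_ofReal
          rw [hyq, div_rpow (by norm_num) (by positivity), mul_rpow pi_pos.le hy.le, one_rpow]
          have h1 : 0 < y ^ q := by positivity
          have h2 : 0 < π ^ q := by positivity
          apply le_of_eq
          field_simp
          ring
  have hu : (univ : Set ℝ) = (Ioi y ∪ Iio (-y)) ∪ Icc (-y) y := by
    ext s; simp; by_cases h : y < s <;> by_cases h' : s < -y <;> simp_all
  rw [← setLIntegral_univ, hu]
  have h3 : 0 < 2*q-1 := by linarith
  calc _ ≤ ENNReal.ofReal (1/(2*q-1) / π ^ q * y ^ (1-q)) + ENNReal.ofReal (1/(2*q-1) / π ^ q * y ^ (1-q))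
        + ENNReal.ofReal (2 / π ^ q * y ^ (1-q)) :=
        (lintegral_union_le _ _ _).trans (add_le_add ((lintegral_union_le _ _ _).trans (add_le_add i1 (i2.le.trans i1))) i3)
    _ = _ := by
      rw [← ENNReal.ofReal_add (by positivity) (by positivity), ← ENNReal.ofReal_add (by positivity) (by positivity)]
      congr 1
      field_simp
      ring

theorem stmt_16 (p : ℝ) (hp : p ∈ Set.Ioc (1 : ℝ) 2) (f : ℝ → ℝ)
    (hfm : Measurable f) (hfp : Integrable (fun t => |f t| ^ p))
    (v : ℝ → ℝ → ℝ)
    (hv : ∀ x₁ x₂, v x₁ x₂ = ∫ t : ℝ, f t * (x₂ / (π * ((t - x₁) ^ 2 + x₂ ^ 2))))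
    (q : ℝ) (hq : q = 2 * p / (3 * p - 2))
    (R : ℝ) (hR : 0 < R) :
    ∫ x₂ in Set.Ioo 0 R, ∫ x₁ : ℝ, (v x₁ x₂) ^ 2
      ≤ (8 * p / (π ^ q * (p + 2))) ^ (2 / q) * (q * R ^ (2 / q - 1) / (2 - q))
          * (∫ t : ℝ, |f t| ^ p) ^ (2 / p) := by
  obtain ⟨hp1, hp2⟩ := hp
  have hd : 0 < 3 * p - 2 := by linarith
  have hp0 : 0 < p := by linarith
  have hq1 : 1 ≤ q := by rw [hq, le_div_iff₀ hd]; linarith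
  have hq2 : q < 2 := by rw [hq, div_lt_iff₀ hd]; linarith
  have hq0 : 0 < q := by linarith
  have hpq : 1/p + 1/q = 3/2 := by rw [hq]; field_simp; ring
  set A := ∫ t : ℝ, |f t| ^ p with hA
  have hA0 : 0 ≤ A := integral_nonneg fun t => by positivity
  set C := 8 * p / (π ^ q * (p + 2)) with hC
  have hC0 : 0 < C := by positivity
  have hd' : 3 * p - 2 ≠ 0 := hd.ne'
  have hCq : 4*q/(2*q-1) / π ^ q = C := by
    have h2 : 2*q-1 = (p+2)/(3*p-2) := by 
      rw [hq, eq_div_iff hd', sub_mul, mul_div_assoc', div_mul_cancel₀ _ hd']; ring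
    have hz : 0 < π ^ q := by positivity
    have h4 : 4 * q / (2*q-1) = 8 * p / (p + 2) := by
      rw [h2, hq, mul_div_assoc', div_div_div_cancel_right₀ hd']; ring
    rw [h4, hC, div_div, mul_comm (p+2)]
  have hF : ∫⁻ t, ‖f t‖ₑ ^ p = ENNReal.ofReal A := by
    rw [hA, ofReal_integral_eq_lintegral_ofReal hfp (ae_of_all _ fun t => by positivity)]
    congr 1; ext t
    rw [← ENNReal.ofReal_rpow_of_nonneg (abs_nonneg _) hp0.le, Real.enorm_eq_ofReal_abs]
  have inner : ∀ y, 0 < y → ∫ x, (v x y) ^ 2 ≤ A ^ (2/p) * (C ^ (2/q) * y ^ (2/q-2)) := by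
    intro y hy
    have hb : 0 ≤ A ^ (2/p) * (C ^ (2/q) * y ^ (2/q-2)) := by positivity
    by_cases hi : Integrable (fun x => (v x y) ^ 2)
    swap
    · rw [integral_undef hi]; exact hb
    rw [← ENNReal.ofReal_le_ofReal_iff hb,
      ofReal_integral_eq_lintegral_ofReal hi (ae_of_all _ fun t => by positivity)]
    calc _ ≤ ∫⁻ x, (∫⁻ t, ‖f t‖ₑ * ‖y / (π * ((t - x) ^ 2 + y ^ 2))‖ₑ) ^ 2 := by
          apply lintegral_mono
          intro x
          dsimp only
          rw [← sq_abs, ENNReal.ofReal_pow (abs_nonneg _), ← Real.enorm_eq_ofReal_abs, hv]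
          apply pow_le_pow_left'
          refine (enorm_integral_le_lintegral_enorm _).trans (le_of_eq ?_)
          simp only [enorm_mul]
      _ ≤ _ := young p q hp1 hp2 hq1 hq2 hpq (fun t => ‖f t‖ₑ)
          (fun s => ‖y / (π * (s ^ 2 + y ^ 2))‖ₑ) (by fun_prop) (by fun_prop)
      _ ≤ ENNReal.ofReal A ^ (2/p) * (ENNReal.ofReal (C * y ^ (1-q))) ^ (2/q) := by
          rw [hF]
          gcongr
          exact (kern q y hq1 hy).trans (le_of_eq (by rw [hCq]))
      _ = _ := by
          rw [ENNReal.ofReal_rpow_of_nonneg hA0 (by positivity),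
            ENNReal.ofReal_rpow_of_nonneg (by positivity) (by positivity),
            ← ENNReal.ofReal_mul (by positivity), mul_rpow hC0.le (by positivity), ← rpow_mul hy.le]
          congr 4
          field_simp
  have he : -1 < 2/q-2 := by
    have : 1 < 2/q := by rw [lt_div_iff₀ hq0]; linarith
    linarith
  have hint : IntegrableOn (fun y : ℝ => y ^ (2/q-2)) (Ioo 0 R) := 
    (intervalIntegral.integrableOn_Ioo_rpow_iff hR).2 he
  calc _ ≤ ∫ y in Ioo 0 R, A ^ (2/p) * (C ^ (2/q) * y ^ (2/q-2)) := by
        apply integral_mono_of_nonneg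
        · exact ae_of_all _ fun y => integral_nonneg fun x => by positivity
        · exact (hint.const_mul _).const_mul _
        · filter_upwards [ae_restrict_mem measurableSet_Ioo] with y hy
          exact inner y hy.1
    _ = _ := by
        rw [integral_const_mul, integral_const_mul, ← integral_Ioc_eq_integral_Ioo,
          ← intervalIntegral.integral_of_le hR.le, integral_rpow (Or.inl he),
          show 2/q-2+1 = 2/q-1 by ring, zero_rpow (by linarith)]
        have : 2/q-1 = (2-q)/q := by field_simp
        have h2 : 2 - q ≠ 0 := by linarith
        rw [sub_zero]
        have h3 : R ^ (2/q-1) / (2/q-1) = q * R ^ (2/q-1) / (2-q) := by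
          generalize R ^ (2/q-1) = z
          rw [this]; field_simp
        rw [h3]; ring
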